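/- Let w be a permutation, i ≥ 1 and d ≥ 0. If ζ = t_{p₁q₁}⋯t_{p_dq_d} ∈ X_{i,d}(w) (with the factorization satisfying the defining conditions of X_{i,d}(w)), then q₁, …, q_d are pairwise distinct. If ζ = t_{p₁q₁}⋯t_{p_dq_d} ∈ Y_{i,d}(w) (with the factorization satisfying the defining conditions of Y_{i,d}(w)), then p₁, …, p_d are pairwise distinct. -/

import Mathlib

open scoped Classical

noncomputable section

/-- Permutations of the positive integers. -/
abbrev PPerm := Equiv.Perm ℕ+

/-- A permutation fixes all but finitely many points. -/
def HasFinSupp (w : PPerm) : Prop := {k : ℕ+ | w k ≠ k}.Finite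

/-- The transposition `t_{pq}`. -/
def tr (p q : ℕ+) : PPerm := Equiv.swap p q

/-- The set of inversions `I(w)`. -/
def invSet (w : PPerm) : Set (ℕ+ × ℕ+) := {x | x.1 < x.2 ∧ w x.2 < w x.1}

/-- The length `ℓ(w)` (number of inversions). -/
def len (w : PPerm) : ℕ := (invSet w).ncard

/-- `m_{pq}(z) = #{r > q : z(p) < z(r) < z(q)}`. -/
def mCnt (z : PPerm) (p q : ℕ+) : ℕ := {r : ℕ+ | q < r ∧ z p < z r ∧ z r < z q}.ncard

/-- `m'_{qp}(z) = #{r < p : z(p) < z(r) < z(q)}`. -/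
def m'Cnt (z : PPerm) (q p : ℕ+) : ℕ := {r : ℕ+ | r < p ∧ z p < z r ∧ z r < z q}.ncard

/-- The list of transpositions `t_{p₁q₁}, …, t_{p_dq_d}`. -/
def trList (d : ℕ) (p q : Fin d → ℕ+) : List PPerm := List.ofFn fun j => tr (p j) (q j)

/-- `w_{j+1} = w t_{p₁q₁} ⋯ t_{p_jq_j}` (so `wSeq w d p q 0 = w₁ = w`). -/
def wSeq (w : PPerm) (d : ℕ) (p q : Fin d → ℕ+) (j : ℕ) : PPerm :=
  w * ((trList d p q).take j).prod

/-- The defining conditions on a factorization for membership in `X_{i,d}(w)`. -/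
def IsXFact (w : PPerm) (i d : ℕ) (p q : Fin d → ℕ+) : Prop :=
  (∀ j, (p j : ℕ) ≤ i ∧ i < (q j : ℕ)) ∧
  (∀ j : Fin d, len (wSeq w d p q (j + 1)) = len (wSeq w d p q j) + 1) ∧
  (∀ j k : Fin d, j < k → wSeq w d p q j (p j) < wSeq w d p q k (p k))

/-- The defining conditions on a factorization for membership in `Y_{i,d}(w)`. -/
def IsYFact (w : PPerm) (i d : ℕ) (p q : Fin d → ℕ+) : Prop :=
  (∀ j, (p j : ℕ) ≤ i ∧ i < (q j : ℕ)) ∧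
  (∀ j : Fin d, len (wSeq w d p q (j + 1)) = len (wSeq w d p q j) + 1) ∧
  (∀ j k : Fin d, j < k → wSeq w d p q k (q k) < wSeq w d p q j (q j))

/-- The set `X_{i,d}(w)`. -/
def XSet (w : PPerm) (i d : ℕ) : Set PPerm :=
  {ζ | ∃ p q : Fin d → ℕ+, ζ = (trList d p q).prod ∧ IsXFact w i d p q}

/-- The set `Y_{i,d}(w)`. -/
def YSet (w : PPerm) (i d : ℕ) : Set PPerm :=
  {ζ | ∃ p q : Fin d → ℕ+, ζ = (trList d p q).prod ∧ IsYFact w i d p q}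

/-- `w ∈ S^{(n)}`, i.e. `w(n+1) < w(n+2) < ⋯`. -/
def InSn (n : ℕ) (w : PPerm) : Prop := ∀ k l : ℕ+, (n : ℕ) < (k : ℕ) → k < l → w k < w l

/-- `x₁^{m-1} x₂^{m-2} ⋯ x_{m-1}`, the Schubert polynomial of the longest element of `S_m`. -/
def schubBase (m : ℕ) : MvPolynomial ℕ+ ℤ :=
  ∏ k ∈ Finset.range m, MvPolynomial.X (k.succPNat) ^ (m - 1 - k)

/-- The defining property of the family of Schubert polynomials `w ↦ 𝔖_w`:
the value on dominant "staircase" permutations, together with the divided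
difference recursion `𝔖_{w s_i} = ∂_i 𝔖_w` whenever `ℓ(w s_i) < ℓ(w)`, stated
in the product form `(x_i - x_{i+1}) · 𝔖_{w s_i} = 𝔖_w - s_i 𝔖_w`. -/
def IsSchubertFamily (S : PPerm → MvPolynomial ℕ+ ℤ) : Prop :=
  (∀ m : ℕ, ∀ w : PPerm, (∀ k : ℕ+, (k : ℕ) ≤ m → (w k : ℕ) = m + 1 - (k : ℕ)) →
      (∀ k : ℕ+, m < (k : ℕ) → w k = k) → S w = schubBase m) ∧
  (∀ w : PPerm, ∀ i : ℕ+, len (w * tr i (i + 1)) < len w →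
      (MvPolynomial.X i - MvPolynomial.X (i + 1)) * S (w * tr i (i + 1)) =
        S w - MvPolynomial.rename (Equiv.swap i (i + 1)) (S w))

/-- The complete homogeneous symmetric polynomial `h_d(x₁, …, x_i)`. -/
def hPoly (i d : ℕ) : MvPolynomial ℕ+ ℤ :=
  ∑ m : Sym (Fin i) d, ((m : Multiset (Fin i)).map fun k => MvPolynomial.X (k.val.succPNat)).prod

/-- The elementary symmetric polynomial `e_d(x₁, …, x_i)`. -/
def ePoly (i d : ℕ) : MvPolynomial ℕ+ ℤ :=
  ∑ s ∈ Finset.powersetCard d (Finset.univ : Finset (Fin i)),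
    ∏ k ∈ s, MvPolynomial.X (k.val.succPNat)

/-- Lexicographic order on permutations. -/
def lexLT (u v : PPerm) : Prop := ∃ k : ℕ+, (∀ l, l < k → u l = v l) ∧ u k < v k

/-- Reverse lexicographic order on permutations. -/
def rlexLT (u v : PPerm) : Prop := ∃ k : ℕ+, (∀ l, k < l → u l = v l) ∧ u k < v k

theorem HasFinSupp.finite_invSet {w : PPerm} (hw : HasFinSupp w) : (invSet w).Finite := by
  obtain ⟨N, hN⟩ := hw.bddAbove
  have fixed : ∀ k, N < k → w k = k := fun k hk => by
    by_contra h
    exact absurd (hN h) (not_le.2 hk)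
  refine ((Set.finite_Iic N).prod (Set.finite_Iic N)).subset ?_
  rintro ⟨a, b⟩ ⟨hab, hinv⟩
  have hb : b ≤ N := by
    by_contra! h
    change a < b at hab
    change w b < w a at hinv
    rw [fixed b h] at hinv
    have ha : w a = a := w.injective (fixed (w a) (h.trans hinv))
    rw [ha] at hinv
    exact lt_asymm hab hinv
  exact ⟨hab.le.trans hb, hb⟩

theorem HasFinSupp.mul_tr {w : PPerm} (hw : HasFinSupp w) (p q : ℕ+) :
    HasFinSupp (w * tr p q) := by
  refine (hw.union (Set.toFinite {p, q})).subset fun k hk => ?_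
  by_contra h
  simp only [Set.mem_union, Set.mem_ofPred_eq, Set.mem_insert_iff, Set.mem_singleton_iff, not_or,
    not_not] at h
  apply hk
  rw [Equiv.Perm.mul_apply, tr, Equiv.swap_apply_of_ne_of_ne h.2.1 h.2.2, h.1]

theorem len_le_len_mul_tr {v : PPerm} {p q : ℕ+} (hpq : p < q) (hv : v p < v q)
    (hfin : (invSet (v * tr p q)).Finite) : len v ≤ len (v * tr p q) := by
  let f : ℕ+ × ℕ+ → ℕ+ × ℕ+ := fun x =>
    if tr p q x.1 < tr p q x.2 then (tr p q x.1, tr p q x.2) else x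
  have invol : ∀ a, tr p q (tr p q a) = a := Equiv.swap_apply_self p q
  refine Set.ncard_le_ncard_of_injOn f ?_ ?_ hfin
  · rintro ⟨a, b⟩ ⟨hab, hinv⟩
    change a < b at hab
    change v b < v a at hinv
    by_cases h : tr p q a < tr p q b
    · simp only [f, if_pos h]
      refine ⟨h, ?_⟩
      simpa only [Equiv.Perm.mul_apply, invol] using hinv
    · simp only [f, if_neg h]
      refine ⟨hab, ?_⟩
      simp only [Equiv.Perm.mul_apply]
      simp only [tr, Equiv.swap_apply_def] at h ⊢
      grind
  · rintro ⟨a, b⟩ ⟨hab, -⟩ ⟨c, e⟩ ⟨hce, -⟩ hf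
    change a < b at hab
    change c < e at hce
    simp only [f] at hf
    split_ifs at hf with h₁ h₂ h₂
    all_goals simp only [Prod.mk.injEq] at hf ⊢
    · exact ⟨(tr p q).injective hf.1, (tr p q).injective hf.2⟩
    · rw [← hf.1, ← hf.2, invol, invol] at h₂
      exact absurd hab h₂
    · rw [hf.1, hf.2, invol, invol] at h₁
      exact absurd hce h₁
    · exact hf

theorem apply_lt_apply_of_len_lt {w : PPerm} (hw : HasFinSupp w) {p q : ℕ+} (hpq : p < q)
    (hlen : len w < len (w * tr p q)) : w p < w q := by
  by_contra! h
  have hne : w q < w p := lt_of_le_of_ne h fun e => hpq.ne' (w.injective e)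
  have hself : w * tr p q * tr p q = w := by
    rw [mul_assoc, tr, Equiv.swap_mul_self, mul_one]
  have hle : len (w * tr p q) ≤ len (w * tr p q * tr p q) :=
    len_le_len_mul_tr hpq (by simpa [tr] using hne) (by rw [hself]; exact hw.finite_invSet)
  rw [hself] at hle
  exact absurd hlen (not_lt.2 hle)

section wSeq

variable {w : PPerm} {i d : ℕ} {p q : Fin d → ℕ+}

theorem wSeq_succ (w : PPerm) (p q : Fin d → ℕ+) (j : Fin d) :
    wSeq w d p q (j + 1) = wSeq w d p q j * tr (p j) (q j) := by
  have hj : (j : ℕ) < (trList d p q).length := by simp [trList]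
  rw [wSeq, wSeq, List.prod_take_succ _ _ hj, mul_assoc]
  simp [trList]

theorem wSeq_hasFinSupp (hw : HasFinSupp w) (p q : Fin d → ℕ+) (j : ℕ) (hj : j ≤ d) :
    HasFinSupp (wSeq w d p q j) := by
  induction j with
  | zero => simpa [wSeq] using hw
  | succ j ih =>
    rw [wSeq_succ w p q ⟨j, hj⟩]
    exact (ih (by omega)).mul_tr _ _

theorem wSeq_apply_lt (hw : HasFinSupp w) (hb : ∀ j, (p j : ℕ) ≤ i ∧ i < (q j : ℕ))
    (hlen : ∀ j : Fin d, len (wSeq w d p q (j + 1)) = len (wSeq w d p q j) + 1) (j : Fin d) :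
    wSeq w d p q j (p j) < wSeq w d p q j (q j) := by
  refine apply_lt_apply_of_len_lt (wSeq_hasFinSupp hw p q j j.2.le)
    (PNat.coe_lt_coe _ _ |>.1 ((hb j).1.trans_lt (hb j).2)) ?_
  rw [← wSeq_succ, hlen]
  exact Nat.lt_succ_self _

theorem wSeq_apply_antitone (hw : HasFinSupp w) (hb : ∀ j, (p j : ℕ) ≤ i ∧ i < (q j : ℕ))
    (hlen : ∀ j : Fin d, len (wSeq w d p q (j + 1)) = len (wSeq w d p q j) + 1)
    {r : ℕ+} (hr : i < (r : ℕ)) {j k : ℕ} (hjk : j ≤ k) (hk : k ≤ d) :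
    wSeq w d p q k r ≤ wSeq w d p q j r := by
  induction k, hjk using Nat.le_induction with
  | base => exact le_rfl
  | succ k _ ih =>
    refine le_trans ?_ (ih (by omega))
    have hlt := wSeq_apply_lt hw hb hlen ⟨k, hk⟩
    have hp : r ≠ p ⟨k, hk⟩ := fun e => absurd (hb ⟨k, hk⟩).1 (by rw [← e]; omega)
    rw [wSeq_succ w p q ⟨k, hk⟩, Equiv.Perm.mul_apply, tr]
    by_cases hq : r = q ⟨k, hk⟩
    · rw [hq, Equiv.swap_apply_right]
      exact hlt.le
    · rw [Equiv.swap_apply_of_ne_of_ne hp hq]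

theorem wSeq_apply_monotone (hw : HasFinSupp w) (hb : ∀ j, (p j : ℕ) ≤ i ∧ i < (q j : ℕ))
    (hlen : ∀ j : Fin d, len (wSeq w d p q (j + 1)) = len (wSeq w d p q j) + 1)
    {r : ℕ+} (hr : (r : ℕ) ≤ i) {j k : ℕ} (hjk : j ≤ k) (hk : k ≤ d) :
    wSeq w d p q j r ≤ wSeq w d p q k r := by
  induction k, hjk using Nat.le_induction with
  | base => exact le_rfl
  | succ k _ ih =>
    refine (ih (by omega)).trans ?_
    have hlt := wSeq_apply_lt hw hb hlen ⟨k, hk⟩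
    have hq : r ≠ q ⟨k, hk⟩ := fun e => absurd (hb ⟨k, hk⟩).2 (by rw [← e]; omega)
    rw [wSeq_succ w p q ⟨k, hk⟩, Equiv.Perm.mul_apply, tr]
    by_cases hp : r = p ⟨k, hk⟩
    · rw [hp, Equiv.swap_apply_left]
      exact hlt.le
    · rw [Equiv.swap_apply_of_ne_of_ne hp hq]

theorem IsXFact.q_injective (hw : HasFinSupp w) (h : IsXFact w i d p q) :
    Function.Injective q := by
  obtain ⟨hb, hlen, hmono⟩ := h
  refine Function.Injective.of_lt_imp_ne fun j k hjk e => ?_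
  have hanti := wSeq_apply_antitone hw hb hlen (hb j).2 (Nat.succ_le_of_lt hjk) k.2.le
  rw [Nat.succ_eq_add_one, wSeq_succ, Equiv.Perm.mul_apply, tr, Equiv.swap_apply_right, e] at hanti
  exact lt_irrefl _ (((wSeq_apply_lt hw hb hlen k).trans_le hanti).trans (hmono j k hjk))

theorem IsYFact.p_injective (hw : HasFinSupp w) (h : IsYFact w i d p q) :
    Function.Injective p := by
  obtain ⟨hb, hlen, hanti⟩ := h
  refine Function.Injective.of_lt_imp_ne fun j k hjk e => ?_
  have hmono := wSeq_apply_monotone hw hb hlen (hb j).1 (Nat.succ_le_of_lt hjk) k.2.le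
  rw [Nat.succ_eq_add_one, wSeq_succ, Equiv.Perm.mul_apply, tr, Equiv.swap_apply_left, e] at hmono
  exact lt_irrefl _ ((hmono.trans_lt (wSeq_apply_lt hw hb hlen k)).trans (hanti j k hjk))

end wSeq

/-- In a factorization defining membership in `X_{i,d}(w)` the `q_j` are pairwise
distinct, and in one defining membership in `Y_{i,d}(w)` the `p_j` are pairwise distinct. -/
theorem factorization_distinct (w : PPerm) (hwf : HasFinSupp w) (i d : ℕ) (hi : 1 ≤ i) :
    (∀ p q : Fin d → ℕ+, IsXFact w i d p q → Function.Injective q) ∧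
    (∀ p q : Fin d → ℕ+, IsYFact w i d p q → Function.Injective p) := by
  exact ⟨fun _ _ h => h.q_injective hwf, fun _ _ h => h.p_injective hwf⟩

end
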